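/- arXiv:1205.0080 — 14 statements merged into one kernel-verified Lean document; each statement's English description precedes it below -/
import Mathlib

section
/- The side length √3/2 used in Dürer's heptagon construction underestimates the side of the regular heptagon inscribed in the unit circle: 0 < 2·sin(π/7) − √3/2 < 1/500. -/
open Real

/-- Dürer's heptagon side length `√3/2` underestimates the side `2·sin(π/7)` of the
regular heptagon inscribed in the unit circle, but by less than `1/500`. -/
theorem durer_heptagon_side_underestimate :
    0 < 2 * Real.sin (Real.pi / 7) - Real.sqrt 3 / 2 ∧
    2 * Real.sin (Real.pi / 7) - Real.sqrt 3 / 2 < 1 / 500 := by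
  have hπ := pi_gt_d6
  have hπ' := pi_lt_d6
  set x := π / 7 with hx
  have hl : 0.44879 ≤ x := by linarith
  have hu : x ≤ 0.4488 := by linarith
  have hx0 : 0 < x := by linarith
  have hcube_ge : (0.44879 : ℝ) ^ 3 ≤ x ^ 3 := by gcongr
  have hcube_le : x ^ 3 ≤ 0.4488 ^ 3 := by gcongr
  have hfifth_le : x ^ 5 ≤ 0.4488 ^ 5 := by gcongr
  have hsin_gt := sin_gt_sub_cube hx0
  have hsin_le := (abs_le.mp (sin_bound (x := x) (by rw [abs_of_pos hx0]; linarith))).2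
  rw [abs_of_pos hx0] at hsin_le
  have hsqrt_lt : √3 < 1.7321 := by rw [sqrt_lt' (by norm_num)]; norm_num
  have hsqrt_gt : 1.732 < √3 := by rw [lt_sqrt (by norm_num)]; norm_num
  constructor <;> linarith
end

section
/- In Dürer's heptagon inscribed in the unit circle, after laying off six chords of length √3/2 (each subtending a central angle 2·arcsin(√3/4)), the remaining closing chord is strictly longer than the other sides: 2·sin(π − 6·arcsin(√3/4)) > √3/2. -/
open Real

/-- In Dürer's heptagon inscribed in the unit circle, after six chords of length `√3/2`,
the closing chord `2·sin(π − 6·arcsin(√3/4))` is strictly longer than the other sides. -/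
theorem durer_heptagon_base_longer :
    2 * Real.sin (Real.pi - 6 * Real.arcsin (Real.sqrt 3 / 4)) > Real.sqrt 3 / 2 := by
  have h_sq : Real.sqrt 3 ^ 2 = 3 := Real.sq_sqrt (by norm_num)
  have h_pos : 0 < Real.sqrt 3 := Real.sqrt_pos.mpr (by norm_num)
  set a := Real.arcsin (Real.sqrt 3 / 4)
  have h_sin : Real.sin a = Real.sqrt 3 / 4 :=
    Real.sin_arcsin (by linarith) (by nlinarith)
  have h_cos_nonneg : 0 ≤ Real.cos a := Real.cos_arcsin_nonneg _
  have h_cos_sq : Real.cos a ^ 2 = 13 / 16 := by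
    rw [Real.cos_sq', h_sin, div_pow, h_sq]
    norm_num
  have h_cos : 8 / 9 < Real.cos a := by nlinarith
  have h_sin_three : Real.sin (3 * a) = 9 / 16 * Real.sqrt 3 := by
    rw [Real.sin_three_mul, h_sin]
    linear_combination (-(1 / 16) * Real.sqrt 3) * h_sq
  have h_cos_three : Real.cos (3 * a) = Real.cos a / 4 := by
    rw [Real.cos_three_mul]
    linear_combination (4 * Real.cos a) * h_cos_sq
  rw [Real.sin_pi_sub, show 6 * a = 2 * (3 * a) by ring, Real.sin_two_mul, h_sin_three,
    h_cos_three]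
  nlinarith [mul_lt_mul_of_pos_left h_cos h_pos]
end

section
/- Ptolemy's pentagon construction is exact: the distance from the point f = ((1−√5)/2, 0) to the point d = (0,1) on the unit circle equals the side of the regular pentagon inscribed in the unit circle, i.e. √(1 + ((√5−1)/2)²) = 2·sin(π/5). -/
open Real

/-- Ptolemy's pentagon construction is exact: the distance from `f = ((1−√5)/2, 0)` to
`d = (0,1)`, namely `√(1 + ((√5−1)/2)²)`, equals the side `2·sin(π/5)` of the regular
pentagon inscribed in the unit circle. -/
theorem ptolemy_pentagon_exact :
    Real.sqrt (1 + ((Real.sqrt 5 - 1) / 2) ^ 2) = 2 * Real.sin (Real.pi / 5) := by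
  have hsin : 0 ≤ Real.sin (Real.pi / 5) :=
    Real.sin_nonneg_of_nonneg_of_le_pi (by positivity) (by linarith [Real.pi_pos])
  rw [Real.sqrt_eq_iff_eq_sq (by positivity) (by positivity), mul_pow, Real.sin_sq,
    Real.cos_pi_div_five]
  linear_combination (1 / 2 : ℝ) * Real.sq_sqrt (show (0 : ℝ) ≤ 5 by norm_num)
end

section
/- The base angles of Dürer's fixed-compass pentagon exceed the regular pentagon angle of 108° by about 21′58″: writing α = 3π/4 − arcsin(√3·sin(π/12)) for the interior angle at the base vertices, one has 3π/5 < α < 3π/5 + 1/150 (angles in radians). -/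
open Real

theorem sqrt_three_mul_sin_pi_div_twelve : √3 * sin (π / 12) = (3 * √2 - √6) / 4 := by
  have h : π / 12 = π / 3 - π / 4 := by ring
  have h6 : √6 = √2 * √3 := by
    rw [← Real.sqrt_mul (by norm_num)]
    norm_num
  have h3 : √3 * √3 = 3 := Real.mul_self_sqrt (by norm_num)
  rw [h, sin_sub, sin_pi_div_three, cos_pi_div_three, sin_pi_div_four, cos_pi_div_four, h6]
  linear_combination √2 / 4 * h3

theorem sqrt_three_mul_sin_pi_div_twelve_bounds :
    0.44828 < √3 * sin (π / 12) ∧ √3 * sin (π / 12) < 0.4483 := by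
  rw [sqrt_three_mul_sin_pi_div_twelve]
  have h2 : 1.41421 < √2 := Real.lt_sqrt_of_sq_lt (by norm_num)
  have h2' : √2 < 1.41422 := (Real.sqrt_lt' (by norm_num)).2 (by norm_num)
  have h6 : 2.44948 < √6 := Real.lt_sqrt_of_sq_lt (by norm_num)
  have h6' : √6 < 2.4495 := (Real.sqrt_lt' (by norm_num)).2 (by norm_num)
  constructor <;> linarith

/-- The base interior angle `α = 3π/4 − arcsin(√3·sin(π/12))` of Dürer's fixed-compass
pentagon exceeds the regular pentagon angle `3π/5` by less than `1/150` radians. -/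
theorem durer_pentagon_base_angle :
    3 * Real.pi / 5 < 3 * Real.pi / 4 - Real.arcsin (Real.sqrt 3 * Real.sin (Real.pi / 12)) ∧
    3 * Real.pi / 4 - Real.arcsin (Real.sqrt 3 * Real.sin (Real.pi / 12)) <
      3 * Real.pi / 5 + 1 / 150 := by
  obtain ⟨hl, hu⟩ := sqrt_three_mul_sin_pi_div_twelve_bounds
  have hpl := Real.pi_gt_d4
  have hpu := Real.pi_lt_d4
  have upper : arcsin (√3 * sin (π / 12)) < 3 * π / 20 := by
    rw [arcsin_lt_iff_lt_sin' ⟨by linarith, by linarith⟩]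
    have hx : 0.4712 < 3 * π / 20 := by linarith
    have hsin := sin_gt_sub_cube (x := 0.4712) (by norm_num)
    have hmono : sin 0.4712 < sin (3 * π / 20) :=
      sin_lt_sin_of_lt_of_le_pi_div_two (by linarith) (by linarith) hx
    norm_num at hsin hu hmono ⊢
    linarith
  have lower : 3 * π / 20 - 1 / 150 < arcsin (√3 * sin (π / 12)) := by
    rw [lt_arcsin_iff_sin_lt' ⟨by linarith, by linarith⟩]
    have hx : 3 * π / 20 - 1 / 150 < 0.46458 := by linarith
    have hsin := (abs_le.1 (Real.sin_bound (x := 0.46458) (by norm_num [abs_le]))).2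
    rw [abs_of_pos (by norm_num)] at hsin
    have hmono : sin (3 * π / 20 - 1 / 150) < sin 0.46458 :=
      sin_lt_sin_of_lt_of_le_pi_div_two (by linarith) (by linarith) hx
    norm_num at hsin hl hmono ⊢
    linarith
  constructor <;> linarith
end

section
/- Dürer's nonagon is not regular: (17+√105)/36 < cos(2π/9), i.e. the chord ef of his construction subtends a central angle strictly greater than 2π/9. -/
open Real

/-- Dürer's nonagon is not regular: the cosine `(17+√105)/36` of the central angle
subtended by its side chord is strictly less than `cos(2π/9)`, so the chord subtends a
central angle strictly greater than `2π/9`. -/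
theorem durer_nonagon_not_regular :
    (17 + Real.sqrt 105) / 36 < Real.cos (2 * Real.pi / 9) := by
  have hpi := Real.pi_pos
  have hsqrt : Real.sqrt 105 < 10.252 := by
    rw [Real.sqrt_lt' (by norm_num)]
    norm_num
  have htriple : 4 * Real.cos (2 * Real.pi / 9) ^ 3 - 3 * Real.cos (2 * Real.pi / 9) = -1 / 2 := by
    rw [← Real.cos_three_mul, show 3 * (2 * Real.pi / 9) = Real.pi - Real.pi / 3 by ring,
      Real.cos_pi_sub, Real.cos_pi_div_three]
    norm_num
  have hhalf : 1 / 2 < Real.cos (2 * Real.pi / 9) := by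
    rw [← Real.cos_pi_div_three]
    apply Real.cos_lt_cos_of_nonneg_of_le_pi <;> linarith
  have hlower : 0.757 < Real.cos (2 * Real.pi / 9) := by
    by_contra! h
    have hprod := mul_nonneg (sub_nonneg.2 hhalf.le) (sub_nonneg.2 h)
    nlinarith [mul_nonneg hprod (zero_le_one.trans (by linarith : 1 ≤ 2 * cos (2 * π / 9)))]
  linarith
end

section
/- The field extension ℚ(cos(π/9)) of ℚ generated by cos(π/9) (the cosine of 20°) has degree exactly 3 over ℚ. -/
open Polynomial in
/-- The equation `y³ - 3y - 1 = 0` has no rational solution. -/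
theorem Rat.cube_sub_three_mul_sub_one_ne_zero (y : ℚ) : y ^ 3 - 3 * y - 1 ≠ 0 := by
  intro h
  have hmonic : (X ^ 3 - 3 * X - 1 : ℤ[X]).Monic := by monicity!
  obtain ⟨n, rfl, -⟩ := exists_integer_of_is_root_of_monic (r := y) hmonic 
    (by simpa [map_ofNat (aeval y : ℤ[X] →ₐ[ℤ] ℚ) 3] using h)
  replace h : n ^ 3 - 3 * n - 1 = 0 := by
    simp only [algebraMap_int_eq, eq_intCast] at h
    exact_mod_cast h
  have hn : n * (n ^ 2 - 3) = 1 := by linear_combination h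
  rcases Int.eq_one_or_neg_one_of_mul_eq_one hn with rfl | rfl <;> norm_num at hn

open Polynomial in
/-- The minimal polynomial of `cos (π / 9)` over `ℚ`. -/
theorem minpoly_cos_pi_div_nine :
    minpoly ℚ (Real.cos (Real.pi / 9)) = X ^ 3 - C (3 / 4) * X - C (1 / 8) := by
  have hdeg : (X ^ 3 - C (3 / 4) * X - C (1 / 8) : ℚ[X]).natDegree = 3 := by compute_degree!
  have hmonic : (X ^ 3 - C (3 / 4) * X - C (1 / 8) : ℚ[X]).Monic := by monicity!
  refine (minpoly.eq_of_irreducible_of_monic ?_ ?_ hmonic).symm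
  · rw [hmonic.irreducible_iff_roots_eq_zero_of_degree_le_three (by lia) (by lia)]
    refine Multiset.eq_zero_of_forall_notMem fun r hr => ?_
    have h : r ^ 3 - 3 / 4 * r - 1 / 8 = 0 := by
      simpa only [IsRoot.def, eval_sub, eval_mul, eval_pow, eval_X, eval_C] using
        isRoot_of_mem_roots hr
    exact Rat.cube_sub_three_mul_sub_one_ne_zero (2 * r) (by linear_combination 8 * h)
  · have h := Real.cos_three_mul (Real.pi / 9)
    rw [show 3 * (Real.pi / 9) = Real.pi / 3 by ring, Real.cos_pi_div_three] at h
    simp only [map_sub, map_mul, map_pow, aeval_X, aeval_C, eq_ratCast]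
    push_cast
    linear_combination -h / 4

/-- The field extension `ℚ(cos(π/9))` of `ℚ` generated by `cos(π/9)` (the cosine of 20°)
has degree exactly `3` over `ℚ`. -/
theorem cos_twenty_degrees_degree_three :
    Module.finrank ℚ
      (IntermediateField.adjoin ℚ {Real.cos (Real.pi / (9 : ℕ))} : IntermediateField ℚ ℝ) = 3 := by
  have hmin := minpoly_cos_pi_div_nine
  have hint : IsIntegral ℚ (Real.cos (Real.pi / 9)) := by
    refine minpoly.ne_zero_iff.mp fun h0 => ?_
    have := congrArg (Polynomial.coeff · 0) (hmin.symm.trans h0)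
    simp at this
  rw [Nat.cast_ofNat, IntermediateField.adjoin.finrank hint, hmin]
  compute_degree!
end

section
/- Dürer's side length 9/16 for the 11-gon inscribed in the unit circle is accurate to within one part in a thousand: 0 < 2·sin(π/11) − 9/16 < 1/1000. -/
open Real

/-- Dürer's side length `9/16` for the 11-gon inscribed in the unit circle underestimates
the true side `2·sin(π/11)` by less than one part in a thousand. -/
theorem durer_11gon_side_accurate :
    0 < 2 * Real.sin (Real.pi / 11) - 9 / 16 ∧
    2 * Real.sin (Real.pi / 11) - 9 / 16 < 1 / 1000 := by
  have hgt := pi_gt_d6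
  have hlt := pi_lt_d6
  set x := π / 11 with hx
  have hx_lower : (3.141592 / 11 : ℝ) ≤ x := by rw [hx]; linarith
  have hx_upper : x ≤ (3.141593 / 11 : ℝ) := by rw [hx]; linarith
  have hx_pos : 0 < x := by linarith
  have hsin_lower := sin_gt_sub_cube hx_pos
  have hsin_upper := (abs_le.1 (sin_bound (abs_le.2 ⟨by linarith, by linarith⟩ : |x| ≤ 1))).2
  rw [abs_of_pos hx_pos] at hsin_upper
  have hcube_lower : (3.141592 / 11 : ℝ) ^ 3 ≤ x ^ 3 := by gcongr
  have hcube_upper : x ^ 3 ≤ (3.141593 / 11 : ℝ) ^ 3 := by gcongr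
  have hfifth_upper : x ^ 5 ≤ (3.141593 / 11 : ℝ) ^ 5 := by gcongr
  norm_num at hcube_lower hcube_upper hfifth_upper hx_lower hx_upper
  constructor <;> linarith
end

section
/- In Dürer's 11-gon inscribed in the unit circle, after laying off ten chords of length 9/16 (each subtending central angle 2·arcsin(9/32)), the closing base chord is strictly longer than the other sides: 2·sin(π − 10·arcsin(9/32)) > 9/16. -/
open Real

theorem Real.sin_ten_mul (x : ℝ) :
    sin (10 * x) = 2 * cos x * (16 * sin x ^ 5 - 20 * sin x ^ 3 + 5 * sin x) *
      (16 * (cos x ^ 2) ^ 2 - 20 * cos x ^ 2 + 5) := by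
  have hs : sin (5 * x) = 16 * sin x ^ 5 - 20 * sin x ^ 3 + 5 * sin x := by
    rw [show 5 * x = 2 * x + 3 * x by ring, sin_add, sin_two_mul, cos_two_mul, sin_three_mul,
      cos_three_mul]
    rw [show 2 * sin x * cos x * (4 * cos x ^ 3 - 3 * cos x) =
      2 * sin x * (4 * (cos x ^ 2) ^ 2 - 3 * cos x ^ 2) by ring, cos_sq']
    ring
  have hc : cos (5 * x) = cos x * (16 * (cos x ^ 2) ^ 2 - 20 * cos x ^ 2 + 5) := by
    rw [show 5 * x = 2 * x + 3 * x by ring, cos_add, sin_two_mul, cos_two_mul, sin_three_mul,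
      cos_three_mul]
    have h := sin_sq x
    rw [show 2 * sin x * cos x * (3 * sin x - 4 * sin x ^ 3) =
      2 * cos x * (3 * sin x ^ 2 - 4 * (sin x ^ 2) ^ 2) by ring, h]
    ring
  rw [show 10 * x = 2 * (5 * x) by ring, sin_two_mul, hs, hc]
  ring

/-- In Dürer's 11-gon inscribed in the unit circle, after ten chords of length `9/16`,
the closing base chord `2·sin(π − 10·arcsin(9/32))` is strictly longer than the others. -/
theorem durer_11gon_base_longer :
    2 * Real.sin (Real.pi - 10 * Real.arcsin (9 / 32)) > 9 / 16 := by
  have hcos : cos (arcsin (9 / 32)) > 307 / 320 := by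
    rw [cos_arcsin]
    exact Real.lt_sqrt_of_sq_lt (by norm_num)
  have hsin : sin (arcsin (9 / 32)) = 9 / 32 := sin_arcsin (by norm_num) (by norm_num)
  rw [sin_pi_sub, sin_ten_mul, cos_sq', hsin]
  nlinarith only [hcos]
end

section
/- Under Hunrath's reading of Dürer's 13-gon construction, the side length 23/48 = 1/2 − 1/48 slightly overestimates the side of the regular 13-gon inscribed in the unit circle: 0 < 23/48 − 2·sin(π/13) < 1/1500. -/
open Real

/-- Under Hunrath's reading, Dürer's 13-gon side length `23/48` slightly overestimates
the side `2·sin(π/13)` of the regular 13-gon inscribed in the unit circle, by less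
than `1/1500`. -/
theorem durer_13gon_side_accurate :
    0 < 23 / 48 - 2 * Real.sin (Real.pi / 13) ∧
    23 / 48 - 2 * Real.sin (Real.pi / 13) < 1 / 1500 := by
  have hlo : 3.1415 / 13 < π / 13 := by linarith [pi_gt_d4]
  have hhi : π / 13 < 3.1416 / 13 := by linarith [pi_lt_d4]
  generalize π / 13 = x at hlo hhi ⊢
  have hx : 0 < x := lt_trans (by norm_num) hlo
  have hsin := abs_le.1 (sin_bound (x := x) (by rw [abs_of_pos hx]; linarith))
  rw [abs_of_pos hx] at hsin
  have hcube_lo : (3.1415 / 13) ^ 3 ≤ x ^ 3 := by gcongr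
  have hcube_hi : x ^ 3 ≤ (3.1416 / 13) ^ 3 := by gcongr
  have hfifth_hi : x ^ 5 ≤ (3.1416 / 13) ^ 5 := by gcongr
  constructor <;> linarith [hsin.1, hsin.2]
end

section
/- In Dürer's 13-gon (Hunrath's reading) inscribed in the unit circle, after laying off twelve chords of length 23/48, the closing thirteenth chord is slightly shorter than the others but still close in length: 47/100 < 2·sin(π − 12·arcsin(23/96)) < 23/48. -/
open Real

/-- The twelvefold angle formula, linear in `cos x` and polynomial in `sin x`. -/
theorem sin_twelve_mul (x : ℝ) :
    sin (12 * x) = cos x * (4 * sin x * (1 - 2 * sin x ^ 2) *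
      (3 - 64 * sin x ^ 2 * (1 - sin x ^ 2) * (1 - 2 * sin x ^ 2) ^ 2)) := by
  have h4 : sin (4 * x) = 4 * sin x * cos x * (1 - 2 * sin x ^ 2) := by
    rw [show 4 * x = 2 * (2 * x) by ring, sin_two_mul, sin_two_mul, cos_two_mul, cos_sq']
    ring
  rw [show 12 * x = 3 * (4 * x) by ring, sin_three_mul, h4]
  linear_combination (-256 * sin x ^ 3 * cos x * (1 - 2 * sin x ^ 2) ^ 3) * cos_sq' x

/-- In Dürer's 13-gon (Hunrath's reading) inscribed in the unit circle, after twelve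
chords of length `23/48`, the closing thirteenth chord `2·sin(π − 12·arcsin(23/96))`
is slightly shorter than the others but still longer than `47/100`. -/
theorem durer_13gon_closing_chord :
    47 / 100 < 2 * Real.sin (Real.pi - 12 * Real.arcsin (23 / 96)) ∧
    2 * Real.sin (Real.pi - 12 * Real.arcsin (23 / 96)) < 23 / 48 := by
  rw [sin_pi_sub, sin_twelve_mul, cos_arcsin, sin_arcsin (by norm_num) (by norm_num)]
  have hlo : (9708 / 10000 : ℝ) < √(1 - (23 / 96) ^ 2) := by
    apply lt_sqrt_of_sq_lt
    norm_num
  have hhi : √(1 - (23 / 96) ^ 2) < (9709 / 10000 : ℝ) := by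
    rw [sqrt_lt' (by norm_num)]
    norm_num
  constructor <;> norm_num at hlo hhi ⊢ <;> linarith
end

section
/- Dürer's approximate trisection applied to the 60° arc is accurate to within 5·10⁻⁶ radians: with d = √((11 − √105)/6), the trisecting point produced by the construction is X = ((17 − 6d)/18, √3·(6d + 1)/18), and |arctan(√3·(6d+1)/(17−6d)) − π/9| < 5/1000000. -/
open Real

lemma arctan_lt_self_of_pos {x : ℝ} (hx : 0 < x) : arctan x < x := by
  simpa using lt_tan (arctan_pos.2 hx) (arctan_lt_pi_div_two x)

lemma three_mul_arctan {x : ℝ} (h : 3 * x ^ 2 < 1) :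
    3 * arctan x = arctan ((3 * x - x ^ 3) / (1 - 3 * x ^ 2)) := by
  have h₁ : 0 < 1 - x ^ 2 := by nlinarith [sq_nonneg x]
  have h₂ : 2 * x / (1 - x ^ 2) * x < 1 := by
    rw [div_mul_eq_mul_div, div_lt_one h₁]
    linarith
  have h₃ : 1 - 2 * x / (1 - x ^ 2) * x ≠ 0 := by linarith
  rw [show 3 * arctan x = 2 * arctan x + arctan x by ring,
    two_mul_arctan (by nlinarith) (by nlinarith), arctan_add h₂]
  congr 1
  rw [div_eq_div_iff h₃ (by linarith)]
  field_simp
  ring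

lemma pi_div_three_sub_three_mul_arctan {r : ℝ} (hr : 0 ≤ r) (h : 9 * r ^ 2 < 1) :
    π / 3 - 3 * arctan (√3 * r) =
      arctan (√3 * (1 - 3 * r - 9 * r ^ 2 + 3 * r ^ 3) /
        (1 + 9 * r - 9 * r ^ 2 - 9 * r ^ 3)) := by
  have hs : √3 ^ 2 = (3 : ℝ) := sq_sqrt (by norm_num)
  have h₁ : 0 < 1 - 9 * r ^ 2 := by linarith
  have hcube : r ^ 3 ≤ r := by nlinarith
  have hq : 0 < 1 + 9 * r - 9 * r ^ 2 - 9 * r ^ 3 := by linarith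
  have htriple : (3 * (√3 * r) - (√3 * r) ^ 3) / (1 - 3 * (√3 * r) ^ 2) =
      √3 * ((3 * r - 3 * r ^ 3) / (1 - 9 * r ^ 2)) := by
    rw [show (√3 * r) ^ 3 = √3 ^ 2 * √3 * r ^ 3 by ring, mul_pow, hs, ← mul_div_assoc]
    congr 1 <;> ring
  have hnonneg : 0 ≤ (3 * r - 3 * r ^ 3) / (1 - 9 * r ^ 2) :=
    div_nonneg (by linarith) h₁.le
  rw [three_mul_arctan (by rw [mul_pow, hs]; linarith), htriple, ← arctan_sqrt_three,
    sub_eq_add_neg, ← arctan_neg, arctan_add (by nlinarith)]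
  congr 1
  rw [show 1 - √3 * -(√3 * ((3 * r - 3 * r ^ 3) / (1 - 9 * r ^ 2))) =
    1 + √3 ^ 2 * ((3 * r - 3 * r ^ 3) / (1 - 9 * r ^ 2)) by ring, hs,
    div_eq_div_iff (by linarith) hq.ne']
  have hmul := div_mul_cancel₀ (3 * r - 3 * r ^ 3) h₁.ne'
  linear_combination (-4 * √3) * hmul

/-- Dürer's approximate trisection applied to the 60° arc is accurate to within
`5·10⁻⁶` radians: with `d = √((11 − √105)/6)`, the trisecting point produced by the
construction is `X = ((17 − 6d)/18, √3·(6d + 1)/18)`, and the angle `arctan(X_y/X_x)`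
differs from `π/9` by less than `5/1000000`. -/
theorem durer_trisection_60_accuracy (d : ℝ) (X : ℝ × ℝ)
    (hd : d = Real.sqrt ((11 - Real.sqrt 105) / 6))
    (hX : X = ((17 - 6 * d) / 18, Real.sqrt 3 * (6 * d + 1) / 18)) :
    |Real.arctan (Real.sqrt 3 * (6 * d + 1) / (17 - 6 * d)) - Real.pi / 9| <
      5 / 1000000 := by
  have hs : 10246950765959 / 1000000000000 < √105 ∧ √105 < 10246950765960 / 1000000000000 :=
    ⟨lt_sqrt_of_sq_lt (by norm_num), (sqrt_lt' (by norm_num)).2 (by norm_num)⟩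
  have hd₁ : 35427137292 / 100000000000 < d := by
    rw [hd]
    exact lt_sqrt_of_sq_lt (by linarith [hs.2])
  have hd₂ : d < 35427137293 / 100000000000 := by
    rw [hd, sqrt_lt' (by norm_num)]
    linarith [hs.1]
  set r := (6 * d + 1) / (17 - 6 * d) with hr
  have hden : 0 < 17 - 6 * d := by linarith
  have hr₁ : 2101351430 / 10000000000 < r := by
    rw [hr, lt_div_iff₀ hden]
    linarith
  have hr₂ : r < 2101351431 / 10000000000 := by
    rw [hr, div_lt_iff₀ hden]
    linarith
  have hsq₁ : 441567780 / 10000000000 < r ^ 2 := by nlinarith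
  have hsq₂ : r ^ 2 < 441567787 / 10000000000 := by nlinarith
  have hcube₁ : 92788904 / 10000000000 < r ^ 3 := by nlinarith
  have hcube₂ : r ^ 3 < 92788915 / 10000000000 := by nlinarith
  have hsqrt : √3 < (17320509 / 10000000 : ℝ) :=
    (sqrt_lt' (by norm_num)).2 (by norm_num)
  have hnum : 0 < 1 - 3 * r - 9 * r ^ 2 + 3 * r ^ 3 := by linarith
  have hq : 0 < 1 + 9 * r - 9 * r ^ 2 - 9 * r ^ 3 := by linarith
  have herr := pi_div_three_sub_three_mul_arctan (r := r) (by linarith) (by linarith)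
  set y := √3 * (1 - 3 * r - 9 * r ^ 2 + 3 * r ^ 3) /
    (1 + 9 * r - 9 * r ^ 2 - 9 * r ^ 3) with hy
  have hy₁ : 0 < y := by positivity
  have hy₂ : y < 15 / 1000000 := by
    rw [hy, div_lt_iff₀ hq]
    nlinarith
  have hlt := arctan_lt_self_of_pos hy₁
  have hpos := arctan_pos.2 hy₁
  rw [mul_div_assoc, ← hr, abs_lt]
  constructor <;> linarith
end

section
/- In Richmond's 17-gon construction, the sum identity holds: cos(6π/17) + cos(10π/17) = (1/2)·tan((1/4)·arctan 4). -/
open Real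

/-- The Chebyshev recurrence for `2 cos (kθ)`. -/
lemma two_cos_recurrence (θ : ℝ) (k : ℕ) :
    2 * cos ((k + 2 : ℕ) * θ) =
      (2 * cos θ) * (2 * cos ((k + 1 : ℕ) * θ)) - 2 * cos (k * θ) := by
  have h₁ : ((k + 2 : ℕ) : ℝ) * θ = (k + 1 : ℕ) * θ + θ := by push_cast; ring
  have h₂ : (k : ℝ) * θ = (k + 1 : ℕ) * θ - θ := by push_cast; ring
  rw [h₁, h₂, cos_add, cos_sub]
  ring

/-- The Gaussian period `2 cos (6π/17) + 2 cos (10π/17)` is a root of the quartic of the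
periods of length four. -/
lemma period_quartic {t : ℝ} (ht : t = 2 * cos (6 * π / 17) + 2 * cos (10 * π / 17)) :
    t ^ 4 + t ^ 3 - 6 * t ^ 2 - t + 1 = 0 := by
  obtain ⟨θ, hθ⟩ : ∃ θ : ℝ, θ = 2 * π / 17 := ⟨_, rfl⟩
  have h₃ : 6 * π / 17 = (3 : ℕ) * θ := by rw [hθ]; push_cast; ring
  have h₅ : 10 * π / 17 = (5 : ℕ) * θ := by rw [hθ]; push_cast; ring
  have h₈₉ : 2 * cos ((9 : ℕ) * θ) = 2 * cos ((8 : ℕ) * θ) := by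
    rw [← cos_two_pi_sub]
    congr 2
    rw [hθ]; push_cast; ring
  have hx : 2 * cos θ ≠ 2 := by
    have : cos θ < cos 0 :=
      cos_lt_cos_of_nonneg_of_le_pi le_rfl (by rw [hθ]; linarith [pi_pos])
        (by rw [hθ]; linarith [pi_pos])
    rw [cos_zero] at this
    linarith
  have c₂ := two_cos_recurrence θ 0
  have c₃ := two_cos_recurrence θ 1
  have c₄ := two_cos_recurrence θ 2
  have c₅ := two_cos_recurrence θ 3
  have c₆ := two_cos_recurrence θ 4
  have c₇ := two_cos_recurrence θ 5
  have c₈ := two_cos_recurrence θ 6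
  have c₉ := two_cos_recurrence θ 7
  simp only [Nat.reduceAdd, Nat.cast_zero, Nat.cast_one, zero_mul, one_mul, cos_zero, mul_one]
    at c₂ c₃ c₄ c₅ c₆ c₇ c₈ c₉
  rw [h₃, h₅] at ht
  rw [c₉, c₈, c₇, c₆, c₅, c₄, c₃, c₂] at h₈₉
  rw [c₅, c₄, c₃, c₂] at ht
  generalize 2 * cos θ = x at *
  have hm : x ^ 8 + x ^ 7 - 7 * x ^ 6 - 6 * x ^ 5 + 15 * x ^ 4 + 10 * x ^ 3 - 10 * x ^ 2
      - 4 * x + 1 = 0 := by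
    apply mul_left_cancel₀ (sub_ne_zero.mpr hx)
    linear_combination h₈₉
  rw [ht]
  linear_combination (x ^ 12 - x ^ 11 - 8 * x ^ 10 + 7 * x ^ 9 + 20 * x ^ 8 - 13 * x ^ 7 - 17 * x ^ 6
    + 3 * x ^ 5 + 9 * x ^ 4 - 2 * x ^ 3 - 6 * x ^ 2 + 2 * x + 1) * hm

lemma period_mem_Ioo : 2 * cos (6 * π / 17) + 2 * cos (10 * π / 17) ∈ Set.Ioo (0 : ℝ) 1 := by
  have h : 2 * cos (6 * π / 17) + 2 * cos (10 * π / 17) =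
      4 * (sin (π / 34) * cos (2 * π / 17)) := by
    have h₁ : 6 * π / 17 = 8 * π / 17 - 2 * π / 17 := by ring
    have h₂ : 10 * π / 17 = 8 * π / 17 + 2 * π / 17 := by ring
    have h₃ : π / 34 = π / 2 - 8 * π / 17 := by ring
    rw [h₁, h₂, h₃, sin_pi_div_two_sub, cos_add, cos_sub]
    ring
  have hs : 0 < sin (π / 34) := sin_pos_of_pos_of_lt_pi (by positivity) (by linarith [pi_pos])
  have hc : 0 < cos (2 * π / 17) :=
    cos_pos_of_mem_Ioo ⟨by linarith [pi_pos], by linarith [pi_pos]⟩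
  have hs' : sin (π / 34) < π / 34 := sin_lt (by positivity)
  rw [h]
  refine ⟨by positivity, ?_⟩
  have := mul_le_of_le_one_right hs.le (cos_le_one (2 * π / 17))
  linarith [pi_lt_four]

lemma four_mul_arctan_eq_arctan_four {t : ℝ} (ht : t ∈ Set.Ioo (0 : ℝ) 1)
    (h : t ^ 4 + t ^ 3 - 6 * t ^ 2 - t + 1 = 0) : 4 * arctan t = arctan 4 := by
  obtain ⟨h₀, h₁⟩ := ht
  have hd : 0 < 1 - t ^ 2 := by nlinarith
  obtain ⟨u, hu⟩ : ∃ u, u = 2 * t / (1 - t ^ 2) := ⟨_, rfl⟩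
  have hu₀ : 0 < u := by rw [hu]; positivity
  have hq : 2 * u = 4 * (1 - u ^ 2) := by
    rw [hu]
    field_simp
    linear_combination (-4) * h
  have hu₁ : u < 1 := by nlinarith
  have e₁ : 2 * arctan t = arctan u := by
    rw [hu]; exact two_mul_arctan (by linarith) h₁
  have e₂ : 2 * arctan u = arctan 4 := by
    rw [two_mul_arctan (by linarith) hu₁, hq, mul_div_cancel_right₀]
    nlinarith
  linarith

/-- Richmond's 17-gon construction, sum identity:
`cos(6π/17) + cos(10π/17) = (1/2)·tan((1/4)·arctan 4)`. -/
theorem richmond_17gon_sum :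
    Real.cos (6 * Real.pi / 17) + Real.cos (10 * Real.pi / 17) =
      (1 / 2) * Real.tan ((1 / 4) * Real.arctan 4) := by
  rw [← four_mul_arctan_eq_arctan_four period_mem_Ioo (period_quartic rfl), ← mul_assoc]
  norm_num [tan_arctan]
  ring
end

section
/- In Richmond's 17-gon construction, the product identity holds: cos(6π/17) · cos(10π/17) = (1/4)·tan((1/4)·arctan 4 − π/4). -/
open Real

/-- `2 cos (2πk/17)`, the sum of a 17th root of unity and its inverse. -/
noncomputable def twoCos (k : ℤ) : ℝ := 2 * Real.cos (2 * Real.pi * k / 17)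

lemma twoCos_mul (a b : ℤ) : twoCos a * twoCos b = twoCos (a + b) + twoCos (a - b) := by
  have h₁ : 2 * Real.pi * ((a + b : ℤ) : ℝ) / 17 =
      2 * Real.pi * a / 17 + 2 * Real.pi * b / 17 := by push_cast; ring
  have h₂ : 2 * Real.pi * ((a - b : ℤ) : ℝ) / 17 =
      2 * Real.pi * a / 17 - 2 * Real.pi * b / 17 := by push_cast; ring
  simp only [twoCos]
  rw [h₁, h₂, Real.cos_add, Real.cos_sub]
  ring

lemma twoCos_reflect (k : ℤ) : twoCos (17 - k) = twoCos k := by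
  have h : 2 * Real.pi * ((17 - k : ℤ) : ℝ) / 17 = 2 * Real.pi - 2 * Real.pi * k / 17 := by
    push_cast; ring
  simp only [twoCos, h, Real.cos_two_pi_sub]

lemma twoCos_zero : twoCos 0 = 2 := by simp [twoCos]

lemma one_lt_twoCos_one : 1 < twoCos 1 := by
  have h : Real.cos (Real.pi / 3) < Real.cos (2 * Real.pi * (1 : ℤ) / 17) := by
    apply Real.cos_lt_cos_of_nonneg_of_le_pi <;> push_cast <;> linarith [Real.pi_pos]
  rw [Real.cos_pi_div_three] at h
  simp only [twoCos]
  linarith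

lemma twoCos_one_lt_two : twoCos 1 < 2 := by
  have h : Real.cos (2 * Real.pi * (1 : ℤ) / 17) < Real.cos 0 := by
    apply Real.cos_lt_cos_of_nonneg_of_le_pi <;> push_cast <;> linarith [Real.pi_pos]
  rw [Real.cos_zero] at h
  simp only [twoCos]
  linarith

lemma twoCos_four_pos : 0 < twoCos 4 := by
  have h : 0 < Real.cos (2 * Real.pi * (4 : ℤ) / 17) := by
    apply Real.cos_pos_of_mem_Ioo
    constructor <;> push_cast <;> linarith [Real.pi_pos]
  simp only [twoCos]
  linarith

lemma twoCos_sum : twoCos 1 + twoCos 2 + twoCos 3 + twoCos 4 + twoCos 5 + twoCos 6 +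
    twoCos 7 + twoCos 8 = -1 := by
  have h₁ := twoCos_mul 1 1
  have h₂ := twoCos_mul 2 1
  have h₃ := twoCos_mul 3 1
  have h₄ := twoCos_mul 4 1
  have h₅ := twoCos_mul 5 1
  have h₆ := twoCos_mul 6 1
  have h₇ := twoCos_mul 7 1
  have h₈ := twoCos_mul 8 1
  have r := twoCos_reflect 8
  norm_num [twoCos_zero] at h₁ h₂ h₃ h₄ h₅ h₆ h₇ h₈ r
  have hne : twoCos 1 - 2 ≠ 0 := by linarith [twoCos_one_lt_two]
  apply mul_left_cancel₀ hne
  linear_combination h₁ + h₂ + h₃ + h₄ + h₅ + h₆ + h₇ + h₈ + r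

/-- The two quartic sub-periods of the period of quadratic residues have product `-1`. -/
lemma quartic_period_mul : (twoCos 1 + twoCos 4) * (twoCos 2 + twoCos 8) = -1 := by
  have h₁ := twoCos_mul 2 1
  have h₂ := twoCos_mul 8 1
  have h₃ := twoCos_mul 4 2
  have h₄ := twoCos_mul 8 4
  have r₁ := twoCos_reflect 8
  have r₂ := twoCos_reflect 5
  norm_num at h₁ h₂ h₃ h₄ r₁ r₂
  linear_combination h₁ + h₂ + h₃ + h₄ + r₁ + r₂ + twoCos_sum

/-- The quadratic equation of the Gaussian period of quadratic residues modulo 17. -/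
lemma quadratic_period_sq : (twoCos 1 + twoCos 4 + (twoCos 2 + twoCos 8)) ^ 2 =
    4 - (twoCos 1 + twoCos 4 + (twoCos 2 + twoCos 8)) := by
  have s₁ := twoCos_mul 1 1
  have s₂ := twoCos_mul 2 2
  have s₄ := twoCos_mul 4 4
  have s₈ := twoCos_mul 8 8
  have h₁ := twoCos_mul 4 1
  have h₂ := twoCos_mul 8 2
  have r₁ := twoCos_reflect 1
  have r₂ := twoCos_reflect 7
  norm_num [twoCos_zero] at s₁ s₂ s₄ s₈ h₁ h₂ r₁ r₂
  linear_combination s₁ + s₂ + s₄ + s₈ + 2 * h₁ + 2 * h₂ + r₁ + 2 * r₂ +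
    2 * quartic_period_mul + 2 * twoCos_sum

lemma four_mul_arctan_of_periods {y z : ℝ} (hz : 1 < z) (hyz : z * y = -1)
    (hsq : (z + y) ^ 2 = 4 - (z + y)) : 4 * Real.arctan y = Real.arctan 4 - Real.pi := by
  have hy₀ : y < 0 := by nlinarith
  have hy₁ : -1 < y := by nlinarith
  have hη : 0 < z + y := by linarith
  have hη₂ : z + y < 2 := by nlinarith
  have hy₂ : 1 - y ^ 2 ≠ 0 := by nlinarith
  have hdouble : 2 * y / (1 - y ^ 2) = -2 / (z + y) := by
    rw [div_eq_div_iff hy₂ hη.ne']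
    linear_combination 2 * hyz
  have hlt : -2 / (z + y) < -1 := by
    rw [div_lt_iff₀ hη]
    linarith
  have hquad : 2 * (-2 / (z + y)) / (1 - (-2 / (z + y)) ^ 2) = 4 := by
    have hd : 1 - (-2 / (z + y)) ^ 2 ≠ 0 := by nlinarith
    rw [div_eq_iff hd]
    field_simp
    linear_combination -4 * hsq
  have h₁ := Real.two_mul_arctan hy₁ (by linarith)
  have h₂ := Real.two_mul_arctan_sub_pi hlt
  rw [hdouble] at h₁
  rw [hquad] at h₂
  linarith

lemma cos_mul_cos_eq_twoCos : Real.cos (6 * Real.pi / 17) * Real.cos (10 * Real.pi / 17) =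
    (1 / 4) * (twoCos 2 + twoCos 8) := by
  have h := twoCos_mul 5 3
  have h₃ : twoCos 3 = 2 * Real.cos (6 * Real.pi / 17) := by
    simp only [twoCos]; push_cast; ring_nf
  have h₅ : twoCos 5 = 2 * Real.cos (10 * Real.pi / 17) := by
    simp only [twoCos]; push_cast; ring_nf
  norm_num at h
  rw [h₃, h₅] at h
  linear_combination h / 4

/-- Richmond's 17-gon construction, product identity:
`cos(6π/17) · cos(10π/17) = (1/4)·tan((1/4)·arctan 4 − π/4)`. -/
theorem richmond_17gon_product :
    Real.cos (6 * Real.pi / 17) * Real.cos (10 * Real.pi / 17) =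
      (1 / 4) * Real.tan ((1 / 4) * Real.arctan 4 - Real.pi / 4) := by
  have h := four_mul_arctan_of_periods (by linarith [one_lt_twoCos_one, twoCos_four_pos])
    quartic_period_mul quadratic_period_sq
  have hx : (1 / 4) * Real.arctan 4 - Real.pi / 4 = Real.arctan (twoCos 2 + twoCos 8) := by
    linarith
  rw [hx, Real.tan_arctan, cos_mul_cos_eq_twoCos]
end

section
/- Gauss's radical expression for the 17-gon: 16·cos(2π/17) = −1 + √17 + √(34 − 2√17) + 2·√(17 + 3√17 − √(34 − 2√17) − 2·√(34 + 2√17)). -/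
open Real

/-- The trace `ζ ^ k + ζ ^ (-k)` of a power of the 17th root of unity `ζ = exp (2πi / 17)`. -/
noncomputable def gaussTrace (k : ℕ) : ℝ := 2 * Real.cos (k * (2 * Real.pi / 17))

namespace gaussTrace

theorem zero : gaussTrace 0 = 2 := by simp [gaussTrace]

theorem mul_add_left (n d : ℕ) :
    gaussTrace n * gaussTrace (n + d) = gaussTrace (2 * n + d) + gaussTrace d := by
  have h₁ := Real.cos_add ((n + d : ℕ) * (2 * π / 17)) (n * (2 * π / 17))
  have h₂ := Real.cos_sub ((n + d : ℕ) * (2 * π / 17)) (n * (2 * π / 17))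
  rw [show ((n + d : ℕ) * (2 * π / 17) + n * (2 * π / 17) : ℝ) =
    (2 * n + d : ℕ) * (2 * π / 17) by push_cast; ring] at h₁
  rw [show ((n + d : ℕ) * (2 * π / 17) - n * (2 * π / 17) : ℝ) =
    d * (2 * π / 17) by push_cast; ring] at h₂
  unfold gaussTrace
  linear_combination -2 * h₁ - 2 * h₂

theorem reflect {j k : ℕ} (h : j + k = 17) : gaussTrace j = gaussTrace k := by
  have hj : (j : ℝ) = 17 - k := by
    rw [eq_sub_iff_add_eq]
    exact_mod_cast h
  rw [gaussTrace, gaussTrace, hj,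
    show (17 - k : ℝ) * (2 * π / 17) = 2 * π - k * (2 * π / 17) by ring, Real.cos_two_pi_sub]

theorem lt_of_lt {j k : ℕ} (hjk : j < k) (hk : k ≤ 8) : gaussTrace k < gaussTrace j := by
  have hjk' : (j : ℝ) < k := by exact_mod_cast hjk
  have hk' : (k : ℝ) ≤ 8 := by exact_mod_cast hk
  have hpi := Real.pi_pos
  have := Real.cos_lt_cos_of_nonneg_of_le_pi (x := j * (2 * π / 17)) (y := k * (2 * π / 17))
    (by positivity) (by nlinarith) (by gcongr)
  unfold gaussTrace
  linarith

/-- A product of two traces as a sum of traces, with the larger index reflected modulo `17`. -/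
theorem mul_of_le {n d : ℕ} (l : ℕ) (hl : 2 * n + d = l ∨ 2 * n + d + l = 17) :
    gaussTrace n * gaussTrace (n + d) = gaussTrace l + gaussTrace d := by
  rw [mul_add_left]
  rcases hl with rfl | hl
  · rfl
  · rw [reflect hl]

theorem sum_eq_neg_one :
    gaussTrace 1 + gaussTrace 2 + gaussTrace 3 + gaussTrace 4 + gaussTrace 5 + gaussTrace 6 +
      gaussTrace 7 + gaussTrace 8 = -1 := by
  have h₁ := mul_of_le (n := 1) (d := 0) 2 (by simp)
  have h₂ := mul_of_le (n := 1) (d := 1) 3 (by simp)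
  have h₃ := mul_of_le (n := 1) (d := 2) 4 (by simp)
  have h₄ := mul_of_le (n := 1) (d := 3) 5 (by simp)
  have h₅ := mul_of_le (n := 1) (d := 4) 6 (by simp)
  have h₆ := mul_of_le (n := 1) (d := 5) 7 (by simp)
  have h₇ := mul_of_le (n := 1) (d := 6) 8 (by simp)
  have h₈ := mul_of_le (n := 1) (d := 7) 8 (by simp)
  have hlt := lt_of_lt (j := 0) (k := 1) (by simp) (by simp)
  norm_num only [zero] at *
  have hne : gaussTrace 1 - 2 ≠ 0 := by linarith
  apply mul_left_cancel₀ hne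
  linear_combination h₁ + h₂ + h₃ + h₄ + h₅ + h₆ + h₇ + h₈

theorem one_add_four_mul_two_add_eight :
    (gaussTrace 1 + gaussTrace 4) * (gaussTrace 2 + gaussTrace 8) = -1 := by
  have h₁ := mul_of_le (n := 1) (d := 1) 3 (by simp)
  have h₂ := mul_of_le (n := 1) (d := 7) 8 (by simp)
  have h₃ := mul_of_le (n := 2) (d := 2) 6 (by simp)
  have h₄ := mul_of_le (n := 4) (d := 4) 5 (by simp)
  norm_num only at *
  linear_combination h₁ + h₂ + h₃ + h₄ + sum_eq_neg_one

theorem three_add_five_mul_six_add_seven :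
    (gaussTrace 3 + gaussTrace 5) * (gaussTrace 6 + gaussTrace 7) = -1 := by
  have h₁ := mul_of_le (n := 3) (d := 3) 8 (by simp)
  have h₂ := mul_of_le (n := 3) (d := 4) 7 (by simp)
  have h₃ := mul_of_le (n := 5) (d := 1) 6 (by simp)
  have h₄ := mul_of_le (n := 5) (d := 2) 5 (by simp)
  norm_num only at *
  linear_combination h₁ + h₂ + h₃ + h₄ + sum_eq_neg_one

theorem one_mul_four : gaussTrace 1 * gaussTrace 4 = gaussTrace 3 + gaussTrace 5 := by
  rw [mul_of_le (n := 1) (d := 3) 5 (by simp), add_comm]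

theorem octic_period_sq :
    (gaussTrace 1 + gaussTrace 2 + gaussTrace 4 + gaussTrace 8) ^ 2 =
      4 - (gaussTrace 1 + gaussTrace 2 + gaussTrace 4 + gaussTrace 8) := by
  have h₁ := mul_of_le (n := 1) (d := 0) 2 (by simp)
  have h₂ := mul_of_le (n := 2) (d := 0) 4 (by simp)
  have h₃ := mul_of_le (n := 4) (d := 0) 8 (by simp)
  have h₄ := mul_of_le (n := 8) (d := 0) 1 (by simp)
  have h₅ := mul_of_le (n := 2) (d := 6) 7 (by simp)
  norm_num only [zero] at *
  linear_combination h₁ + h₂ + h₃ + h₄ + 2 * one_mul_four + 2 * h₅ +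
    2 * one_add_four_mul_two_add_eight + 2 * sum_eq_neg_one

/-- The relation between the square roots generating the two quadratic extensions of `ℚ(√17)`
by the periods of length four. -/
theorem period_difference_relation :
    (gaussTrace 1 + gaussTrace 2 + gaussTrace 4 + gaussTrace 8 + 1) *
        (gaussTrace 1 + gaussTrace 4 - (gaussTrace 2 + gaussTrace 8)) =
      2 * (gaussTrace 3 + gaussTrace 5 - (gaussTrace 6 + gaussTrace 7)) := by
  have h₁ := mul_of_le (n := 1) (d := 0) 2 (by simp)
  have h₂ := mul_of_le (n := 2) (d := 0) 4 (by simp)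
  have h₃ := mul_of_le (n := 4) (d := 0) 8 (by simp)
  have h₄ := mul_of_le (n := 8) (d := 0) 1 (by simp)
  have h₅ := mul_of_le (n := 2) (d := 6) 7 (by simp)
  norm_num only [zero] at *
  linear_combination h₁ - h₂ + h₃ - h₄ + 2 * one_mul_four - 2 * h₅

theorem octic_period_pos :
    0 < gaussTrace 1 + gaussTrace 2 + gaussTrace 4 + gaussTrace 8 := by
  have hpi := Real.pi_pos
  have h₂ : 1 < gaussTrace 2 := by
    have := Real.cos_lt_cos_of_nonneg_of_le_pi (x := (2 : ℕ) * (2 * π / 17)) (y := π / 3)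
      (by positivity) (by linarith) (by push_cast; linarith)
    rw [Real.cos_pi_div_three] at this
    unfold gaussTrace
    linarith
  have h₄ : 0 < gaussTrace 4 := by
    have := Real.cos_pos_of_mem_Ioo (x := (4 : ℕ) * (2 * π / 17))
      ⟨by push_cast; linarith, by push_cast; linarith⟩
    unfold gaussTrace
    linarith
  have h₈ : -2 ≤ gaussTrace 8 := by
    have := Real.neg_one_le_cos ((8 : ℕ) * (2 * π / 17))
    unfold gaussTrace
    linarith
  linarith [lt_of_lt (j := 1) (k := 2) (by simp) (by simp)]

end gaussTrace

/-- Gauss's radical expression for the regular 17-gon: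
`16·cos(2π/17) = −1 + √17 + √(34 − 2√17)
  + 2·√(17 + 3√17 − √(34 − 2√17) − 2·√(34 + 2√17))`. -/
theorem gauss_17gon_radical :
    16 * Real.cos (2 * Real.pi / 17) =
      -1 + Real.sqrt 17 + Real.sqrt (34 - 2 * Real.sqrt 17) +
        2 * Real.sqrt (17 + 3 * Real.sqrt 17 - Real.sqrt (34 - 2 * Real.sqrt 17) -
          2 * Real.sqrt (34 + 2 * Real.sqrt 17)) := by
  have h₁₂ := gaussTrace.lt_of_lt (j := 1) (k := 2) (by simp) (by simp)
  have h₁₄ := gaussTrace.lt_of_lt (j := 1) (k := 4) (by simp) (by simp)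
  have h₄₈ := gaussTrace.lt_of_lt (j := 4) (k := 8) (by simp) (by simp)
  have h₃₆ := gaussTrace.lt_of_lt (j := 3) (k := 6) (by simp) (by simp)
  have h₅₇ := gaussTrace.lt_of_lt (j := 5) (k := 7) (by simp) (by simp)
  have hpos := gaussTrace.octic_period_pos
  have hsum := gaussTrace.sum_eq_neg_one
  have hsq := gaussTrace.octic_period_sq
  have hpq := gaussTrace.one_add_four_mul_two_add_eight
  have hrs := gaussTrace.three_add_five_mul_six_add_seven
  have hmul := gaussTrace.one_mul_four
  have hrel := gaussTrace.period_difference_relation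
  have hcos : 16 * Real.cos (2 * Real.pi / 17) = 8 * gaussTrace 1 := by
    rw [gaussTrace, Nat.cast_one, one_mul]
    ring
  generalize gaussTrace 1 = x₁ at *
  generalize gaussTrace 2 = x₂ at *
  generalize gaussTrace 3 = x₃ at *
  generalize gaussTrace 4 = x₄ at *
  generalize gaussTrace 5 = x₅ at *
  generalize gaussTrace 6 = x₆ at *
  generalize gaussTrace 7 = x₇ at *
  generalize gaussTrace 8 = x₈ at *
  have hs : Real.sqrt 17 = 2 * (x₁ + x₂ + x₄ + x₈) + 1 := by
    rw [Real.sqrt_eq_iff_mul_self_eq_of_pos (by linarith)]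
    linear_combination 4 * hsq
  have hA : Real.sqrt (34 - 2 * Real.sqrt 17) = 2 * (x₁ + x₄ - (x₂ + x₈)) := by
    rw [Real.sqrt_eq_iff_mul_self_eq_of_pos (by linarith), hs]
    linear_combination 4 * hsq - 16 * hpq
  have hB : Real.sqrt (34 + 2 * Real.sqrt 17) = 2 * (x₃ + x₅ - (x₆ + x₇)) := by
    have hb : x₃ + x₅ + x₆ + x₇ = -1 - (x₁ + x₂ + x₄ + x₈) := by linarith
    rw [Real.sqrt_eq_iff_mul_self_eq_of_pos (by linarith), hs]
    linear_combination 4 * (x₃ + x₅ + x₆ + x₇ - 1 - (x₁ + x₂ + x₄ + x₈)) * hb + 4 * hsq - 16 * hrs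
  have hC : Real.sqrt (17 + 3 * Real.sqrt 17 - Real.sqrt (34 - 2 * Real.sqrt 17) -
      2 * Real.sqrt (34 + 2 * Real.sqrt 17)) = 2 * (x₁ - x₄) := by
    rw [Real.sqrt_eq_iff_mul_self_eq_of_pos (by linarith), hA, hB, hs]
    linear_combination 2 * hsq + 2 * hrel - 4 * hpq - 16 * hmul - 8 * hsum
  rw [hcos, hC, hA, hs]
  ring
end
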